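/- arXiv:1009.5147 — 4 statements merged into one kernel-verified Lean document; each statement's English description precedes it below -/
import Mathlib

section
/- In the presented Heisenberg algebra 𝔥, for every vertex i ∈ I and all integers n, m ≥ 0 one has q_i^{(n)}·p_i^{(m)} = Σ_{k=0}^{min(m,n)} [k+1]·p_i^{(m−k)}·q_i^{(n−k)} (equivalently Σ_{k≥0}, with the convention that terms with negative superscripts vanish). This is relation (3) of the paper's defining presentation of the Heisenberg algebra, proved in Lemma 1 to hold for the elements defined from the generators aᵢ(n). -/
/-!
We formalize the quantum Heisenberg algebra `𝔥` associated to a simple graph with vertex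
set `I` (in the paper, the affine Dynkin diagram of a nontrivial finite subgroup
`Γ ⊂ SL₂(ℂ)`, `Γ ≠ ℤ/2`), presented over `K = ℚ(t)` by generators `aᵢ(n)` (`i ∈ I`,
`n ∈ ℤ ∖ {0}`) and the relations
`aᵢ(m)aⱼ(n) = aⱼ(n)aᵢ(m)` for `m + n ≠ 0` and
`aᵢ(-n)aⱼ(n) - aⱼ(n)aᵢ(-n) = κᵢⱼ(n)·1` for `n ≥ 1`, where `κᵢᵢ(n) = -[2n][n]/n`,
`κᵢⱼ(n) = (-1)ⁿ[n]²/n` if `i ∼ j` and `κᵢⱼ(n) = 0` otherwise.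
-/

open scoped Classical

noncomputable section

/-- The base field `K = ℚ(t)`. -/
abbrev K : Type := RatFunc ℚ

/-- The variable `t ∈ K = ℚ(t)`. -/
def tv : K := RatFunc.X

/-- The quantum integer `[n] = (tⁿ - t⁻ⁿ)/(t - t⁻¹)`. -/
def qint (n : ℤ) : K := (tv ^ n - tv ^ (-n)) / (tv - tv⁻¹)

/-- The quantum integer `[k+1] = t^{-k} + t^{-k+2} + ⋯ + t^{k-2} + t^k`. -/
def qnat (k : ℕ) : K := ∑ j ∈ Finset.range (k + 1), tv ^ (2 * (j : ℤ) - (k : ℤ))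

/-- Index type for the generators `aᵢ(n)`, `i ∈ I`, `n ∈ ℤ ∖ {0}`. -/
abbrev Gen (I : Type) : Type := I × {n : ℤ // n ≠ 0}

/-- The structure constants `κᵢⱼ(n)`:  `κᵢᵢ(n) = -[2n][n]/n`,
`κᵢⱼ(n) = (-1)ⁿ[n]²/n` if `i ∼ j`, and `κᵢⱼ(n) = 0` otherwise. -/
def kappa {I : Type} (G : SimpleGraph I) (i j : I) (n : ℤ) : K :=
  if i = j then -(qint (2 * n) * qint n / (n : K))
  else if G.Adj i j then (-1 : K) ^ n * qint n ^ 2 / (n : K)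
  else 0

/-- The defining relations of the Heisenberg algebra:
`aᵢ(m)aⱼ(n) = aⱼ(n)aᵢ(m)` whenever `m + n ≠ 0`, and
`aᵢ(-n)aⱼ(n) - aⱼ(n)aᵢ(-n) = κᵢⱼ(n)·1` for all `n ≥ 1`. -/
inductive HeisRel {I : Type} (G : SimpleGraph I) :
    FreeAlgebra K (Gen I) → FreeAlgebra K (Gen I) → Prop
  | comm (i j : I) (m n : {k : ℤ // k ≠ 0}) (h : (m : ℤ) + (n : ℤ) ≠ 0) :
      HeisRel G (FreeAlgebra.ι K (i, m) * FreeAlgebra.ι K (j, n))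
        (FreeAlgebra.ι K (j, n) * FreeAlgebra.ι K (i, m))
  | heis (i j : I) (n : ℤ) (hn : 1 ≤ n) :
      HeisRel G
        (FreeAlgebra.ι K (i, ⟨-n, by omega⟩) * FreeAlgebra.ι K (j, ⟨n, by omega⟩) -
          FreeAlgebra.ι K (j, ⟨n, by omega⟩) * FreeAlgebra.ι K (i, ⟨-n, by omega⟩))
        (algebraMap K (FreeAlgebra K (Gen I)) (kappa G i j n))

/-- The Heisenberg algebra `𝔥`, presented by generators and relations. -/
abbrev HeisAlg {I : Type} (G : SimpleGraph I) : Type := RingQuot (HeisRel G)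

/-- The generators `aᵢ(n)` of `𝔥` (with the harmless convention `aᵢ(0) = 0`). -/
def aGen {I : Type} (G : SimpleGraph I) (i : I) (n : ℤ) : HeisAlg G :=
  if h : n ≠ 0 then RingQuot.mkAlgHom K (HeisRel G) (FreeAlgebra.ι K (i, ⟨n, h⟩)) else 0

/-- `p_i^{(n)}` for `n : ℕ`, defined by `p_i^{(0)} = 1` and the recursion
`n·p_i^{(n)} = Σ_{m=1}^{n} (m/[m])·aᵢ(-m)·p_i^{(n-m)}`. -/
def pAux {I : Type} (G : SimpleGraph I) (i : I) : ℕ → HeisAlg G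
  | 0 => 1
  | n + 1 =>
      (((n : K) + 1))⁻¹ • ∑ m ∈ Finset.range (n + 1),
        ((((m : K) + 1)) / qint ((m : ℤ) + 1)) •
          (aGen G i (-((m : ℤ) + 1)) * pAux G i (n - m))
  decreasing_by exact Nat.lt_succ_of_le (Nat.sub_le n m)

/-- `q_i^{(n)}` for `n : ℕ`, defined by `q_i^{(0)} = 1` and the recursion
`n·q_i^{(n)} = Σ_{m=1}^{n} (m/[m])·aᵢ(m)·q_i^{(n-m)}`. -/
def qAux {I : Type} (G : SimpleGraph I) (i : I) : ℕ → HeisAlg G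
  | 0 => 1
  | n + 1 =>
      (((n : K) + 1))⁻¹ • ∑ m ∈ Finset.range (n + 1),
        ((((m : K) + 1)) / qint ((m : ℤ) + 1)) •
          (aGen G i ((m : ℤ) + 1) * qAux G i (n - m))
  decreasing_by exact Nat.lt_succ_of_le (Nat.sub_le n m)

/-- `p_i^{(k)}` for `k : ℤ`, vanishing for `k < 0`. -/
def pH {I : Type} (G : SimpleGraph I) (i : I) (k : ℤ) : HeisAlg G :=
  if k < 0 then 0 else pAux G i k.toNat

/-- `q_i^{(k)}` for `k : ℤ`, vanishing for `k < 0`. -/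
def qH {I : Type} (G : SimpleGraph I) (i : I) (k : ℤ) : HeisAlg G :=
  if k < 0 then 0 else qAux G i k.toNat

section EulerOperator

open PowerSeries

variable {A : Type*} [Ring A]

/-- The Euler operator `X · d/dX` on power series over a possibly noncommutative ring. -/
def euler (F : PowerSeries A) : PowerSeries A := PowerSeries.mk fun n => n • coeff n F

@[simp]
theorem coeff_euler (F : PowerSeries A) (n : ℕ) : coeff n (euler F) = n • coeff n F :=
  coeff_mk _ _

theorem euler_sub (F H : PowerSeries A) : euler (F - H) = euler F - euler H := by
  ext n
  simp [smul_sub]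

theorem euler_mul (F H : PowerSeries A) : euler (F * H) = euler F * H + F * euler H := by
  ext n
  simp only [coeff_euler, map_add, coeff_mul, Finset.smul_sum, ← Finset.sum_add_distrib]
  refine Finset.sum_congr rfl fun x hx => ?_
  rw [← Finset.HasAntidiagonal.mem_antidiagonal.mp hx, add_smul, smul_mul_assoc, mul_smul_comm]

@[simp]
theorem euler_C (a : A) : euler (C a) = 0 := by
  ext n
  rcases n with _ | n <;> simp [coeff_C]

theorem euler_monomial (m : ℕ) (a : A) : euler (monomial m a) = m • monomial m a := by
  ext n
  rw [coeff_euler, map_nsmul, coeff_monomial]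
  split_ifs with h <;> simp [h]

/-- Solutions of `X · F' = L · F` with `L(0) = 0` are determined by their constant term. -/
theorem eq_of_euler_eq_mul [IsAddTorsionFree A] {L F H : PowerSeries A}
    (hL : coeff 0 L = 0) (hF : euler F = L * F) (hH : euler H = L * H)
    (h0 : coeff 0 F = coeff 0 H) : F = H := by
  ext n
  induction n using Nat.strong_induction_on with
  | _ n ih =>
    rcases Nat.eq_zero_or_pos n with rfl | hn
    · exact h0
    · refine nsmul_right_injective hn.ne' ?_
      simp only
      rw [← coeff_euler, ← coeff_euler, hF, hH, coeff_mul, coeff_mul]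
      refine Finset.sum_congr rfl fun x hx => ?_
      have hx := Finset.HasAntidiagonal.mem_antidiagonal.mp hx
      rcases Nat.eq_zero_or_pos x.1 with h1 | h1
      · rw [h1, hL, zero_mul, zero_mul]
      · rw [ih x.2 (by omega)]

theorem euler_mk_eq_mul {α x : ℕ → A} (hα : α 0 = 0)
    (hx : ∀ n, (n + 1) • x (n + 1) = ∑ m ∈ Finset.range (n + 1), α (m + 1) * x (n - m)) :
    euler (PowerSeries.mk x) = PowerSeries.mk α * PowerSeries.mk x := by
  ext n
  rw [coeff_euler, coeff_mul, Finset.Nat.sum_antidiagonal_eq_sum_range_succ_mk]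
  rcases n with _ | n
  · simp [hα]
  · simp [Finset.sum_range_succ' _ (n + 1), hα, hx]

/-- If `a` commutes with the coefficients of `L` up to the central element `m • s` in degree `m`,
and `X · P' = L · P`, then `[a, P] = s X ^ m P`. -/
theorem commutator_eq_monomial_mul [IsAddTorsionFree A] {L P : PowerSeries A} {a s : A} {m : ℕ}
    (hm : m ≠ 0) (hs : ∀ b : A, Commute s b) (hL : coeff 0 L = 0) (hP : euler P = L * P)
    (ha : Commute a (coeff 0 P)) (h : C a * L - L * C a = monomial m (m • s)) :
    C a * P - P * C a = monomial m s * P := by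
  have hmon : monomial m s * L = L * monomial m s := by
    ext n
    simp only [coeff_mul, coeff_monomial]
    rw [← Finset.Nat.sum_antidiagonal_swap]
    refine Finset.sum_congr rfl fun x _ => ?_
    simp only [Prod.fst_swap, Prod.snd_swap]
    split_ifs
    · exact hs _
    · simp
  rw [← sub_eq_zero]
  refine eq_of_euler_eq_mul hL ?_ (by ext; simp) ?_
  · have hmonP : monomial m s * (L * P) = L * (monomial m s * P) := by
      rw [← mul_assoc, hmon, mul_assoc]
    simp only [euler_sub, euler_mul, euler_C, euler_monomial, hP]
    rw [← map_nsmul, ← h, hmonP]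
    noncomm_ring
  · have h0 : constantCoeff (monomial m s) = 0 := by
      rw [← coeff_zero_eq_constantCoeff_apply, coeff_monomial, if_neg hm.symm]
    simpa [h0, sub_eq_zero] using ha.eq

/-- Normal ordering of the coefficients of `Q` and `P`, where `X · Q' = mk α · Q` and
`[αⱼ, P] = sⱼ X ^ j P`; the structure constants `h` solve `X · h' = s · h`. -/
theorem normal_order {α q p s h : ℕ → A} [IsAddTorsionFree A] (hα : α 0 = 0)
    (hq : euler (PowerSeries.mk q) = PowerSeries.mk α * PowerSeries.mk q) (hq0 : q 0 = 1)
    (hc : ∀ j, C (α j) * PowerSeries.mk p - PowerSeries.mk p * C (α j) =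
      monomial j (s j) * PowerSeries.mk p)
    (hcomm : ∀ k (b : A), Commute (h k) b)
    (hh : euler (PowerSeries.mk h) = PowerSeries.mk s * PowerSeries.mk h) (hh0 : h 0 = 1)
    (n m : ℕ) :
    q n * p m = ∑ k ∈ Finset.range (min m n + 1), h k * (p (m - k) * q (n - k)) := by
  set H : PowerSeries A := PowerSeries.mk fun k => if k ≤ m then h k * p (m - k) else 0 with hH
  have hα_p (j l : ℕ) : α j * p l = p l * α j + if j ≤ l then s j * p (l - j) else 0 := by
    have := congrArg (coeff l) (hc j)
    rw [map_sub, coeff_C_mul, coeff_mul_C, coeff_mk, coeff_mul] at this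
    rw [← sub_eq_iff_eq_add', this, Finset.Nat.sum_antidiagonal_eq_sum_range_succ_mk]
    simp [coeff_monomial]
  have hbracket : PowerSeries.mk α * H = H * PowerSeries.mk α + euler H := by
    ext l
    have hl : l • h l = ∑ x ∈ Finset.HasAntidiagonal.antidiagonal l, s x.1 * h x.2 := by
      simpa [coeff_mul] using congrArg (coeff l) hh
    have hterm : ∀ x ∈ Finset.HasAntidiagonal.antidiagonal l, α x.1 * coeff x.2 H =
        coeff x.2 H * α x.1 + if l ≤ m then s x.1 * h x.2 * p (m - l) else 0 := by
      rintro ⟨j, k⟩ hx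
      obtain rfl : j + k = l := Finset.HasAntidiagonal.mem_antidiagonal.mp hx
      simp only [hH, coeff_mk]
      by_cases hk : k ≤ m
      · rw [if_pos hk, ← mul_assoc, ← (hcomm k (α j)).eq, mul_assoc, hα_p, mul_add, mul_assoc]
        by_cases hjk : j + k ≤ m
        · rw [if_pos (by omega), if_pos hjk, ← mul_assoc (h k) (s j), (hcomm k (s j)).eq,
            show m - k - j = m - (j + k) by omega]
        · rw [if_neg (by omega), if_neg hjk, mul_zero]
      · rw [if_neg hk, if_neg (by omega), mul_zero, zero_mul, add_zero]
    rw [map_add, coeff_euler, coeff_mul, coeff_mul, ← Finset.Nat.sum_antidiagonal_swap (n := l)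
      (f := fun x => coeff x.1 H * coeff x.2 (PowerSeries.mk α))]
    simp only [coeff_mk, Prod.fst_swap, Prod.snd_swap]
    rw [Finset.sum_congr rfl hterm, Finset.sum_add_distrib]
    congr 1
    by_cases hlm : l ≤ m
    · simp [hH, hlm, ← smul_mul_assoc, hl, Finset.sum_mul]
    · simp [hH, hlm]
  have key : PowerSeries.mk q * C (p m) = H * PowerSeries.mk q := by
    refine eq_of_euler_eq_mul (L := PowerSeries.mk α) (by simpa using hα) ?_ ?_ ?_
    · rw [euler_mul, hq, euler_C, mul_zero, add_zero, mul_assoc]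
    · rw [euler_mul, hq, ← mul_assoc, ← mul_assoc, hbracket, add_mul, add_comm]
    · simp [hH, coeff_mul, hq0, hh0]
  have := congrArg (coeff n) key
  rw [coeff_mul_C, coeff_mk, coeff_mul, Finset.Nat.sum_antidiagonal_eq_sum_range_succ_mk] at this
  rw [this]
  symm
  refine Finset.sum_subset_zero_on_sdiff (fun k => ?_) (fun k hk => ?_) fun k hk => ?_
  · simp only [Finset.mem_range]; omega
  · simp only [Finset.mem_sdiff, Finset.mem_range] at hk
    simp [hH, show ¬ k ≤ m by omega]
  · simp only [Finset.mem_range] at hk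
    simp [hH, show k ≤ m by omega, mul_assoc]

end EulerOperator

theorem tv_ne_zero : tv ≠ 0 := RatFunc.X_ne_zero

theorem tv_pow_ne_one {n : ℕ} (hn : n ≠ 0) : tv ^ n ≠ 1 := by
  intro h
  have : (Polynomial.X : Polynomial ℚ) ^ n = 1 := by
    apply RatFunc.algebraMap_injective ℚ
    simpa [tv] using h
  have := congrArg Polynomial.natDegree this
  simp at this
  exact hn this

theorem tv_zpow_sub_ne_zero {n : ℕ} (hn : n ≠ 0) : tv ^ (n : ℤ) - tv ^ (-(n : ℤ)) ≠ 0 := by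
  intro h
  refine tv_pow_ne_one (n := n + n) (by omega) ?_
  rw [sub_eq_zero, zpow_neg, zpow_natCast] at h
  rw [pow_add]
  nth_rewrite 1 [h]
  exact inv_mul_cancel₀ (pow_ne_zero _ tv_ne_zero)

theorem tv_sub_inv_ne_zero : tv - tv⁻¹ ≠ 0 := by
  simpa using tv_zpow_sub_ne_zero one_ne_zero

theorem qint_ne_zero {n : ℕ} (hn : n ≠ 0) : qint n ≠ 0 :=
  div_ne_zero (tv_zpow_sub_ne_zero hn) tv_sub_inv_ne_zero

theorem qint_two_mul (n : ℤ) : qint (2 * n) = (tv ^ n + tv ^ (-n)) * qint n := by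
  have h1 : tv ^ (2 * n) = tv ^ n * tv ^ n := by rw [two_mul, zpow_add₀ tv_ne_zero]
  have h2 : tv ^ (-(2 * n)) = tv ^ (-n) * tv ^ (-n) := by
    rw [← zpow_add₀ tv_ne_zero]; congr 1; ring
  rw [qint, qint, h1, h2]
  ring

/-- The power sums `tⁿ + t⁻ⁿ` for `n ≥ 1`, extended by `0` to `n = 0`. -/
def powerSum (n : ℕ) : K := if n = 0 then 0 else tv ^ (n : ℤ) + tv ^ (-(n : ℤ))

theorem euler_mk_pow (x : K) :
    euler (PowerSeries.mk fun n => x ^ n) =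
      (PowerSeries.mk fun n => if n = 0 then 0 else x ^ n) * PowerSeries.mk fun n => x ^ n := by
  refine euler_mk_eq_mul (by simp) fun n => ?_
  rw [Finset.sum_congr rfl (g := fun _ => x ^ (n + 1))]
  · simp
  · intro m hm
    have hm := Finset.mem_range.mp hm
    rw [if_neg m.succ_ne_zero, ← pow_add]
    congr 1
    omega

theorem mk_qnat :
    PowerSeries.mk qnat =
      (PowerSeries.mk fun n => tv ^ n) * PowerSeries.mk fun n => tv⁻¹ ^ n := by
  ext n
  rw [PowerSeries.coeff_mul, Finset.Nat.sum_antidiagonal_eq_sum_range_succ_mk,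
    PowerSeries.coeff_mk, qnat]
  refine Finset.sum_congr rfl fun j hj => ?_
  have hj := Finset.mem_range.mp hj
  rw [PowerSeries.coeff_mk, PowerSeries.coeff_mk, inv_pow, ← zpow_natCast, ← zpow_natCast,
    ← zpow_neg, ← zpow_add₀ tv_ne_zero]
  congr 1
  omega

theorem euler_mk_qnat :
    euler (PowerSeries.mk qnat) = PowerSeries.mk powerSum * PowerSeries.mk qnat := by
  have : PowerSeries.mk powerSum = (PowerSeries.mk fun n => if n = 0 then 0 else tv ^ n) +
      PowerSeries.mk fun n => if n = 0 then 0 else tv⁻¹ ^ n := by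
    ext n
    by_cases hn : n = 0 <;> simp [powerSum, hn]
  rw [mk_qnat, euler_mul, euler_mk_pow, euler_mk_pow, this]
  ring

theorem smul_mul_sub_smul_mul {R A : Type*} [CommRing R] [Ring A] [Algebra R A] (c d : R)
    (x y : A) : (c • x) * (d • y) - (d • y) * (c • x) = (c * d) • (x * y - y * x) := by
  rw [smul_mul_smul_comm, smul_mul_smul_comm, mul_comm d, smul_sub]

section Heisenberg

variable {I : Type} (G : SimpleGraph I) (i : I)

/-- The rescaled generators `(n / [n]) aᵢ(εn)`, for a sign `ε`. -/
def scaledGen (ε : ℤ) (n : ℕ) : HeisAlg G := ((n : K) / qint n) • aGen G i (ε * n)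

theorem scaledGen_zero (ε : ℤ) : scaledGen G i ε 0 = 0 := by
  simp [scaledGen]

theorem euler_mk_pAux : euler (PowerSeries.mk (pAux G i)) =
    PowerSeries.mk (scaledGen G i (-1)) * PowerSeries.mk (pAux G i) := by
  refine euler_mk_eq_mul (scaledGen_zero G i _) fun n => ?_
  rw [pAux, ← Nat.cast_smul_eq_nsmul K, Nat.cast_succ, smul_inv_smul₀ (Nat.cast_add_one_ne_zero n)]
  simp [scaledGen]

theorem euler_mk_qAux : euler (PowerSeries.mk (qAux G i)) =
    PowerSeries.mk (scaledGen G i 1) * PowerSeries.mk (qAux G i) := by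
  refine euler_mk_eq_mul (scaledGen_zero G i _) fun n => ?_
  rw [qAux, ← Nat.cast_smul_eq_nsmul K, Nat.cast_succ, smul_inv_smul₀ (Nat.cast_add_one_ne_zero n)]
  simp [scaledGen]

theorem aGen_mul_comm (j : I) {m n : ℤ} (h : m + n ≠ 0) :
    aGen G i m * aGen G j n = aGen G j n * aGen G i m := by
  by_cases hm : m = 0
  · simp [aGen, hm]
  by_cases hn : n = 0
  · simp [aGen, hn]
  have := RingQuot.mkAlgHom_rel K (HeisRel.comm (G := G) i j ⟨m, hm⟩ ⟨n, hn⟩ h)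
  simpa only [aGen, ne_eq, hm, hn, not_false_eq_true, dif_pos, map_mul] using this

theorem aGen_commutator (j : I) {n : ℤ} (hn : 1 ≤ n) :
    aGen G i (-n) * aGen G j n - aGen G j n * aGen G i (-n) =
      algebraMap K (HeisAlg G) (kappa G i j n) := by
  have := RingQuot.mkAlgHom_rel K (HeisRel.heis (G := G) i j n hn)
  have h0 : n ≠ 0 := by omega
  simpa only [aGen, ne_eq, h0, neg_eq_zero, not_false_eq_true, dif_pos, map_mul, map_sub,
    AlgHom.commutes] using this

theorem scaledGen_commutator (m n : ℕ) :
    scaledGen G i 1 m * scaledGen G i (-1) n - scaledGen G i (-1) n * scaledGen G i 1 m =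
      if n = m then m • algebraMap K (HeisAlg G) (powerSum m) else 0 := by
  refine (smul_mul_sub_smul_mul (R := K) (A := HeisAlg G) _ _ _ _).trans ?_
  split_ifs with h
  · subst h
    rcases Nat.eq_zero_or_pos n with rfl | hn
    · simp
    have hq := qint_ne_zero hn.ne'
    have hn0 : (n : K) ≠ 0 := Nat.cast_ne_zero.mpr hn.ne'
    rw [one_mul, neg_one_mul, ← neg_sub, aGen_commutator G i i (n := n) (by omega), ← map_neg,
      Algebra.smul_def, ← map_mul, ← map_nsmul, kappa, if_pos rfl, powerSum, if_neg hn.ne',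
      qint_two_mul, nsmul_eq_mul, Int.cast_natCast]
    congr 1
    field_simp
  · rw [aGen_mul_comm G i i (by omega), sub_self, smul_zero]

end Heisenberg

/-- relation (3) of the paper's presentation, Lemma 1:
`q_i^{(n)}·p_i^{(m)} = Σ_{k=0}^{min(m,n)} [k+1]·p_i^{(m-k)}·q_i^{(n-k)}` in `𝔥`. -/
theorem heisenberg_rel_qp_same {I : Type} (G : SimpleGraph I) (i : I) (n m : ℕ) :
    qH G i n * pH G i m =
      ∑ k ∈ Finset.range (min m n + 1),
        qnat k • (pH G i ((m : ℤ) - (k : ℤ)) * qH G i ((n : ℤ) - (k : ℤ))) := by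
  have : IsAddTorsionFree (HeisAlg G) := .of_isTorsionFree K _
  have hL : PowerSeries.coeff 0 (PowerSeries.mk (scaledGen G i (-1))) = 0 := by
    simp [scaledGen_zero]
  have hc (j : ℕ) :
      PowerSeries.C (scaledGen G i 1 j) * PowerSeries.mk (pAux G i) -
        PowerSeries.mk (pAux G i) * PowerSeries.C (scaledGen G i 1 j) =
      PowerSeries.monomial j (algebraMap K (HeisAlg G) (powerSum j)) *
        PowerSeries.mk (pAux G i) := by
    rcases Nat.eq_zero_or_pos j with rfl | hj
    · simp [scaledGen_zero, powerSum]
    refine commutator_eq_monomial_mul hj.ne' (Algebra.commutes _) hL (euler_mk_pAux G i)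
      (by simp [pAux]) ?_
    · ext l
      simpa [PowerSeries.coeff_monomial] using scaledGen_commutator G i j l
  have hh : euler (PowerSeries.mk fun k => algebraMap K (HeisAlg G) (qnat k)) =
      (PowerSeries.mk fun k => algebraMap K (HeisAlg G) (powerSum k)) *
        PowerSeries.mk fun k => algebraMap K (HeisAlg G) (qnat k) := by
    ext l
    simpa [PowerSeries.coeff_mul] using
      congrArg (algebraMap K (HeisAlg G)) (congrArg (PowerSeries.coeff l) euler_mk_qnat)
  have key := normal_order (scaledGen_zero G i 1) (euler_mk_qAux G i) (by rw [qAux]) hc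
    (fun _ => Algebra.commutes _) hh (by simp [qnat]) n m
  have hp (l : ℕ) : pH G i l = pAux G i l := by simp [pH]
  have hq (l : ℕ) : qH G i l = qAux G i l := by simp [qH]
  rw [hp, hq, key]
  refine Finset.sum_congr rfl fun k hk => ?_
  have hk := Finset.mem_range.mp hk
  rw [← Nat.cast_sub (by omega), ← Nat.cast_sub (by omega), hp, hq, Algebra.smul_def]
end
end

section
/- In the presented Heisenberg algebra 𝔥, for all adjacent vertices i ∼ j of the graph (i ≠ j, so ⟨i,j⟩ = −1 in the paper's quantum Cartan matrix) and all integers n, m ≥ 0 one has q_i^{(n)}·p_j^{(m)} = p_j^{(m)}·q_i^{(n)} + p_j^{(m−1)}·q_i^{(n−1)} (terms with negative superscripts are zero). This is relation (4) of the paper's defining presentation of the Heisenberg algebra, proved in Lemma 1. -/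
/-!
We formalize the quantum Heisenberg algebra `𝔥` associated to a simple graph with vertex
set `I` (in the paper, the affine Dynkin diagram of a nontrivial finite subgroup
`Γ ⊂ SL₂(ℂ)`, `Γ ≠ ℤ/2`), presented over `K = ℚ(t)` by generators `aᵢ(n)` (`i ∈ I`,
`n ∈ ℤ ∖ {0}`) and the relations
`aᵢ(m)aⱼ(n) = aⱼ(n)aᵢ(m)` for `m + n ≠ 0` and
`aᵢ(-n)aⱼ(n) - aⱼ(n)aᵢ(-n) = κᵢⱼ(n)·1` for `n ≥ 1`, where `κᵢᵢ(n) = -[2n][n]/n`,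
`κᵢⱼ(n) = (-1)ⁿ[n]²/n` if `i ∼ j` and `κᵢⱼ(n) = 0` otherwise.
-/

open scoped Classical

noncomputable section

/-- A sequence solving the Newton-type recursion with coefficients `c` is shifted by commutation
with `b`. -/
theorem mul_eq_mul_add_of_newton {A : Type*} [Ring A] [IsAddTorsionFree A]
    {b c : ℕ → A} {P : ℤ → A}
    (hbc : ∀ k l, b k * c l = c l * b k + if l = k then ((-1) ^ k * (k + 1) : ℤ) • (1 : A) else 0)
    (hneg : ∀ n < 0, P n = 0) (hzero : P 0 = 1)
    (hrec : ∀ (N : ℕ) (n : ℤ), n ≤ N →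
      n • P n = ∑ l ∈ Finset.range N, c l * P (n - 1 - l)) (k : ℕ) (n : ℤ) :
    b k * P n = P n * b k + ((-1) ^ k : ℤ) • P (n - 1 - k) := by
  induction h : n.toNat using Nat.strong_induction_on generalizing n with
  | _ d ih =>
  rcases lt_trichotomy n 0 with hn | rfl | hn
  · simp [hneg n hn, hneg (n - 1 - k) (by omega)]
  · simp [hzero, hneg (-1 - k : ℤ) (by omega)]
  · refine zsmul_right_injective hn.ne' ?_
    have hstep : ∀ l ∈ Finset.range (n.toNat + k + 1), b k * (c l * P (n - 1 - l)) =
        c l * P (n - 1 - l) * b k + ((-1) ^ k : ℤ) • (c l * P (n - 1 - k - 1 - l)) +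
          if l = k then ((-1) ^ k * (k + 1) : ℤ) • P (n - 1 - k) else 0 := by
      intro l _
      have hP : b k * P (n - 1 - l) =
          P (n - 1 - l) * b k + ((-1) ^ k : ℤ) • P (n - 1 - k - 1 - l) := by
        rw [ih (n - 1 - l).toNat (by omega) _ rfl]
        congr 3
        ring
      rw [← mul_assoc, hbc, add_mul, mul_assoc, hP, mul_add, mul_smul_comm, mul_assoc]
      split_ifs with hl
      · rw [hl, smul_mul_assoc, one_mul]
      · rw [zero_mul]
    have h₁ := hrec (n.toNat + k + 1) n (by omega)
    have h₂ := hrec (n.toNat + k + 1) (n - 1 - k) (by omega)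
    change n • (b k * P n) = n • (P n * b k + ((-1) ^ k : ℤ) • P (n - 1 - k))
    rw [← mul_smul_comm, h₁, Finset.mul_sum, Finset.sum_congr rfl hstep,
      Finset.sum_add_distrib, Finset.sum_add_distrib, ← Finset.sum_mul, ← Finset.smul_sum,
      ← h₁, ← h₂, Finset.sum_ite_eq', if_pos (Finset.mem_range.2 (by omega)), smul_mul_assoc]
    module

/-- Alternating sums of consecutive terms telescope. -/
theorem sum_range_neg_one_pow_zsmul_add_succ {A : Type*} [AddCommGroup A] (f : ℕ → A) (N : ℕ) :
    ∑ k ∈ Finset.range N, ((-1) ^ k : ℤ) • (f k + f (k + 1)) = f 0 - ((-1) ^ N : ℤ) • f N := by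
  induction N with
  | zero => simp
  | succ N ih =>
    rw [Finset.sum_range_succ, ih, pow_succ]
    module

/-- If `Q` solves the Newton-type recursion with coefficients `b`, which shift `P`, then `Q` and
`P` satisfy the exchange relation with one correction term. -/
theorem mul_eq_mul_add_mul_of_newton {A : Type*} [Ring A] [IsAddTorsionFree A]
    {b : ℕ → A} {P Q : ℤ → A}
    (hbP : ∀ (k : ℕ) (m : ℤ), b k * P m = P m * b k + ((-1) ^ k : ℤ) • P (m - 1 - k))
    (hneg : ∀ n < 0, Q n = 0) (hzero : Q 0 = 1)
    (hrec : ∀ (N : ℕ) (n : ℤ), n ≤ N →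
      n • Q n = ∑ k ∈ Finset.range N, b k * Q (n - 1 - k)) (n m : ℤ) :
    Q n * P m = P m * Q n + P (m - 1) * Q (n - 1) := by
  induction h : n.toNat using Nat.strong_induction_on generalizing n with
  | _ d ih =>
  rcases lt_trichotomy n 0 with hn | rfl | hn
  · simp [hneg n hn, hneg (n - 1) (by omega)]
  · simp [hzero, hneg (-1) (by omega)]
  · refine zsmul_right_injective hn.ne' ?_
    let f : ℕ → A := fun k ↦ P (m - 1 - k) * Q (n - 1 - k)
    have hstep : ∀ k ∈ Finset.range n.toNat, b k * Q (n - 1 - k) * P m =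
        P m * (b k * Q (n - 1 - k)) + P (m - 1) * (b k * Q (n - 1 - 1 - k)) +
          ((-1) ^ k : ℤ) • (f k + f (k + 1)) := by
      intro k _
      have e₁ : m - 1 - ((k + 1 : ℕ) : ℤ) = m - 1 - 1 - k := by push_cast; ring
      have e₂ : n - 1 - ((k + 1 : ℕ) : ℤ) = n - 1 - 1 - k := by push_cast; ring
      have e₃ : n - 1 - (k : ℤ) - 1 = n - 1 - 1 - k := by ring
      simp only [f, e₁, e₂]
      rw [mul_assoc, ih (n - 1 - k).toNat (by omega) _ rfl, e₃, mul_add, ← mul_assoc, ← mul_assoc,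
        hbP, hbP, add_mul, add_mul, smul_mul_assoc, smul_mul_assoc, mul_assoc, mul_assoc]
      module
    have h₁ := hrec n.toNat n (by omega)
    have h₂ := hrec n.toNat (n - 1) (by omega)
    have hf : f n.toNat = 0 := by
      simp only [f]
      rw [hneg (n - 1 - n.toNat) (by omega), mul_zero]
    change n • (Q n * P m) = n • (P m * Q n + P (m - 1) * Q (n - 1))
    rw [← smul_mul_assoc, h₁, Finset.sum_mul, Finset.sum_congr rfl hstep,
      Finset.sum_add_distrib, Finset.sum_add_distrib, ← Finset.mul_sum, ← Finset.mul_sum,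
      ← h₁, ← h₂, sum_range_neg_one_pow_zsmul_add_succ, hf]
    simp only [f, Nat.cast_zero, sub_zero, mul_smul_comm]
    module

/-- A Newton-type recursion on `ℕ` holds on `ℤ` after extension by zero, with any sufficiently long
range of summation. -/
theorem zsmul_eq_sum_range_of_newton {A : Type*} [Ring A] {c : ℕ → A} {F : ℕ → A} {P : ℤ → A}
    (hF : ∀ d : ℕ, (d + 1) • F (d + 1) = ∑ l ∈ Finset.range (d + 1), c l * F (d - l))
    (hneg : ∀ n < 0, P n = 0) (hP : ∀ d : ℕ, P d = F d) (N : ℕ) (n : ℤ) (hn : n ≤ N) :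
    n • P n = ∑ l ∈ Finset.range N, c l * P (n - 1 - l) := by
  rcases le_or_gt n 0 with h | h
  · rw [Finset.sum_eq_zero fun l _ ↦ by rw [hneg (n - 1 - l) (by omega), mul_zero]]
    rcases h.lt_or_eq with h | rfl
    · rw [hneg n h, smul_zero]
    · exact zero_smul ℤ _
  · obtain ⟨d, rfl⟩ : ∃ d : ℕ, n = ((d + 1 : ℕ) : ℤ) := ⟨(n - 1).toNat, by omega⟩
    rw [hP, natCast_zsmul, hF]
    refine Finset.sum_subset_zero_on_sdiff
      (Finset.range_subset_range.2 (by omega)) (fun l hl ↦ ?_) fun l hl ↦ ?_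
    · simp only [Finset.mem_sdiff, Finset.mem_range] at hl
      rw [hneg _ (by omega), mul_zero]
    · have hl := Finset.mem_range.1 hl
      rw [← hP]
      congr 2
      omega

theorem tv_zpow_sub_zpow_neg_ne_zero (k : ℕ) : tv ^ ((k : ℤ) + 1) - tv ^ (-((k : ℤ) + 1)) ≠ 0 := by
  intro h
  have hpow : tv ^ (2 * (k + 1)) = 1 := by
    have h' := congrArg (· * tv ^ ((k : ℤ) + 1)) (sub_eq_zero.1 h)
    simp only [← zpow_add₀ tv_ne_zero, neg_add_cancel, zpow_zero] at h'
    rw [← h', ← zpow_natCast]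
    congr 1
    push_cast
    ring
  have hX : (Polynomial.X : Polynomial ℚ) ^ (2 * (k + 1)) = 1 := by
    apply RatFunc.algebraMap_injective ℚ
    rw [map_pow, RatFunc.algebraMap_X, map_one]
    exact hpow
  have := congrArg Polynomial.natDegree hX
  rw [Polynomial.natDegree_X_pow, Polynomial.natDegree_one] at this
  omega

theorem qint_succ_ne_zero (k : ℕ) : qint ((k : ℤ) + 1) ≠ 0 := by
  refine div_ne_zero (tv_zpow_sub_zpow_neg_ne_zero k) ?_
  simpa using tv_zpow_sub_zpow_neg_ne_zero 0

theorem smul_mul_smul_eq_add_of_sub_eq_algebraMap {R A : Type*} [CommRing R] [Ring A] [Algebra R A]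
    {x y : A} {κ : R} (h : x * y - y * x = algebraMap R A κ) (r : R) :
    (r • y) * (r • x) = (r • x) * (r • y) + (-(r * r * κ)) • (1 : A) := by
  rw [Algebra.algebraMap_eq_smul_one, sub_eq_iff_eq_add] at h
  rw [smul_mul_smul_comm, smul_mul_smul_comm, h]
  module

section Heisenberg

variable {I : Type} (G : SimpleGraph I) (i j : I)

/-- The coefficients `(m/[m])·aᵢ(-m)`, `m = k + 1`, of the recursion for `p_i`. -/
def pCoeff (k : ℕ) : HeisAlg G := (((k : K) + 1) / qint ((k : ℤ) + 1)) • aGen G i (-((k : ℤ) + 1))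

/-- The coefficients `(m/[m])·aᵢ(m)`, `m = k + 1`, of the recursion for `q_i`. -/
def qCoeff (k : ℕ) : HeisAlg G := (((k : K) + 1) / qint ((k : ℤ) + 1)) • aGen G i ((k : ℤ) + 1)

theorem aGen_mul_aGen_neg_of_ne {k l : ℕ} (h : l ≠ k) :
    aGen G i ((k : ℤ) + 1) * aGen G j (-((l : ℤ) + 1)) =
      aGen G j (-((l : ℤ) + 1)) * aGen G i ((k : ℤ) + 1) := by
  have hk : (k : ℤ) + 1 ≠ 0 := by omega
  have hl : -((l : ℤ) + 1) ≠ 0 := by omega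
  simp only [aGen, dif_pos hk, dif_pos hl, ← map_mul]
  exact RingQuot.mkAlgHom_rel K (HeisRel.comm i j ⟨_, hk⟩ ⟨_, hl⟩ (by dsimp only; omega))

theorem aGen_neg_mul_aGen_sub (k : ℕ) :
    aGen G j (-((k : ℤ) + 1)) * aGen G i ((k : ℤ) + 1) -
      aGen G i ((k : ℤ) + 1) * aGen G j (-((k : ℤ) + 1)) =
        algebraMap K (HeisAlg G) (kappa G j i ((k : ℤ) + 1)) := by
  have hk : (k : ℤ) + 1 ≠ 0 := by omega
  have hl : -((k : ℤ) + 1) ≠ 0 := by omega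
  have h := RingQuot.mkAlgHom_rel K (HeisRel.heis (G := G) j i ((k : ℤ) + 1) (by omega))
  rw [AlgHom.commutes, map_sub, map_mul, map_mul] at h
  simpa only [aGen, dif_pos hk, dif_pos hl] using h

variable {G i j}

theorem qCoeff_mul_pCoeff (hadj : G.Adj i j) (k l : ℕ) :
    qCoeff G i k * pCoeff G j l = pCoeff G j l * qCoeff G i k +
      if l = k then ((-1) ^ k * (k + 1) : ℤ) • (1 : HeisAlg G) else 0 := by
  simp only [qCoeff, pCoeff]
  split_ifs with h
  · subst h
    rw [smul_mul_smul_eq_add_of_sub_eq_algebraMap (aGen_neg_mul_aGen_sub G i j l),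
      ← Int.cast_smul_eq_zsmul K, kappa, if_neg hadj.ne', if_pos hadj.symm]
    congr 2
    have hq := qint_succ_ne_zero l
    have hl : (l : K) + 1 ≠ 0 := Nat.cast_add_one_ne_zero l
    have hpow : (-1 : K) ^ ((l : ℤ) + 1) = -(-1) ^ l := by
      rw [zpow_add_one₀ (by norm_num), zpow_natCast, mul_neg_one]
    rw [hpow]
    push_cast
    field_simp
  · rw [smul_mul_smul_comm, smul_mul_smul_comm, aGen_mul_aGen_neg_of_ne G i j h, mul_comm, add_zero]

variable (G i)

theorem succ_nsmul_pAux (d : ℕ) : (d + 1) • pAux G i (d + 1) =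
    ∑ l ∈ Finset.range (d + 1), pCoeff G i l * pAux G i (d - l) := by
  rw [pAux, ← Nat.cast_smul_eq_nsmul K, Nat.cast_succ,
    smul_inv_smul₀ (Nat.cast_add_one_ne_zero d)]
  simp only [pCoeff, smul_mul_assoc]

theorem succ_nsmul_qAux (d : ℕ) : (d + 1) • qAux G i (d + 1) =
    ∑ l ∈ Finset.range (d + 1), qCoeff G i l * qAux G i (d - l) := by
  rw [qAux, ← Nat.cast_smul_eq_nsmul K, Nat.cast_succ,
    smul_inv_smul₀ (Nat.cast_add_one_ne_zero d)]
  simp only [qCoeff, smul_mul_assoc]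

theorem pH_of_neg (n : ℤ) (hn : n < 0) : pH G i n = 0 := if_pos hn

theorem qH_of_neg (n : ℤ) (hn : n < 0) : qH G i n = 0 := if_pos hn

theorem pH_natCast (d : ℕ) : pH G i d = pAux G i d := if_neg (by omega)

theorem qH_natCast (d : ℕ) : qH G i d = qAux G i d := if_neg (by omega)

theorem pH_zero : pH G i 0 = 1 := (pH_natCast G i 0).trans (by rw [pAux])

theorem qH_zero : qH G i 0 = 1 := (qH_natCast G i 0).trans (by rw [qAux])

end Heisenberg

/-- relation (4) of the paper's presentation, Lemma 1: for adjacent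
vertices `i ∼ j`, `q_i^{(n)}·p_j^{(m)} = p_j^{(m)}·q_i^{(n)} + p_j^{(m-1)}·q_i^{(n-1)}`
in `𝔥`. -/
theorem heisenberg_rel_qp_adjacent {I : Type} (G : SimpleGraph I) (i j : I)
    (hadj : G.Adj i j) (n m : ℕ) :
    qH G i n * pH G j m =
      pH G j m * qH G i n +
        pH G j ((m : ℤ) - 1) * qH G i ((n : ℤ) - 1) := by
  have : IsAddTorsionFree (HeisAlg G) := .of_isTorsionFree K _
  have hqp := mul_eq_mul_add_of_newton (qCoeff_mul_pCoeff hadj) (pH_of_neg G j) (pH_zero G j)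
    (zsmul_eq_sum_range_of_newton (succ_nsmul_pAux G j) (pH_of_neg G j) (pH_natCast G j))
  exact mul_eq_mul_add_mul_of_newton hqp (qH_of_neg G i) (qH_zero G i)
    (zsmul_eq_sum_range_of_newton (succ_nsmul_qAux G i) (qH_of_neg G i) (qH_natCast G i)) n m
end
end

section
/- The trace tr on B^Γ = Λ*(V) ⋊ Γ is supersymmetric: for all homogeneous elements a, b ∈ B^Γ one has tr(a·b) = (−1)^{|a||b|}·tr(b·a). (Note that this uses Γ ⊆ SL(V), i.e. that every γ ∈ Γ has determinant 1 on V.) -/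
/-!
The algebra `B^Γ = Λ*(V) ⋊ Γ` for a finite subgroup `Γ ⊂ SL(V) ≅ SL₂(𝕜)`, where `V` is
a two-dimensional `𝕜`-vector space with fixed basis `v₁, v₂` (modelled as `Fin 2 → 𝕜`
with its standard basis).  As a `𝕜`-vector space `B^Γ = Λ*(V) ⊗ 𝕜[Γ]`, modelled as
finitely supported functions `Γ →₀ Λ*(V)` (so `(x, γ)` is `single γ x`), with the smash
product multiplication `(x, γ)·(y, δ) = (x ∧ γ·y, γδ)`, and with the trace
`tr((ω, 1)) = 1` (`ω = v₁ ∧ v₂`), `tr = 0` on all other basis elements.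
-/

noncomputable section

variable (𝕜 : Type) [Field 𝕜] [IsAlgClosed 𝕜] [CharZero 𝕜]

/-- The two-dimensional vector space `V`. -/
abbrev V (𝕜 : Type) [Field 𝕜] : Type := Fin 2 → 𝕜

/-- The exterior algebra `Λ*(V)`. -/
abbrev ExtV (𝕜 : Type) [Field 𝕜] : Type := ExteriorAlgebra 𝕜 (V 𝕜)

/-- The algebra endomorphism of `Λ*(V)` induced functorially by a linear map `V → V`. -/
def actE (f : V 𝕜 →ₗ[𝕜] V 𝕜) : ExtV 𝕜 →ₐ[𝕜] ExtV 𝕜 :=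
  ExteriorAlgebra.lift 𝕜
    ⟨(ExteriorAlgebra.ι 𝕜).comp f, fun m => ExteriorAlgebra.ι_sq_zero (f m)⟩

variable (Γ : Subgroup (Matrix.SpecialLinearGroup (Fin 2) 𝕜)) [Finite Γ]

/-- The underlying `𝕜`-vector space of `B^Γ = Λ*(V) ⋊ Γ`: finitely supported functions
`Γ →₀ Λ*(V)`; the element `(x, γ)` is `Finsupp.single γ x`. -/
abbrev BG : Type := Γ →₀ ExtV 𝕜

/-- The smash product multiplication on `B^Γ`:
`(x, γ)·(y, δ) = (x ∧ (γ·y), γδ)`, extended bilinearly.  Here `γ ∈ Γ ⊂ SL₂(𝕜)` acts on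
`Λ*(V)` through its (matrix) action on `V`. -/
def mulB (f g : BG 𝕜 Γ) : BG 𝕜 Γ :=
  f.sum fun α x => g.sum fun β y =>
    Finsupp.single (α * β)
      (x * actE 𝕜 (Matrix.toLin' ((α : Matrix.SpecialLinearGroup (Fin 2) 𝕜) :
        Matrix (Fin 2) (Fin 2) 𝕜)) y)

/-- The family of alternating maps defining the `ω`-coefficient functional on `Λ*(V)`:
the determinant in degree `2` and zero in all other degrees. -/
def altFam : ∀ i : ℕ, (V 𝕜) [⋀^Fin i]→ₗ[𝕜] 𝕜
  | 2 => Matrix.detRowAlternating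
  | _ => 0

/-- The `ω`-coefficient functional `Λ*(V) → 𝕜`: the unique linear map vanishing in
degrees `≠ 2` and sending `ι v * ι w` to `det(v, w)`; in particular it sends
`ω = v₁ ∧ v₂` to `1` and kills `1, v₁, v₂`. -/
def omegaCoeff : ExtV 𝕜 →ₗ[𝕜] 𝕜 :=
  ExteriorAlgebra.liftAlternating (altFam 𝕜)

/-- The trace `tr : B^Γ → 𝕜`, with `tr((ω, 1)) = 1` and `tr = 0` on `(x, γ)` for
`γ ≠ 1` or `x` of exterior degree `≤ 1`. -/
def trB (b : BG 𝕜 Γ) : 𝕜 := omegaCoeff 𝕜 (b 1)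

/-- `b ∈ B^Γ` is homogeneous of degree `d` if every `Λ*(V)`-component of `b` lies in the
`d`-th graded piece `Λᵈ(V)` (the `d`-th power of the image of `V` in `Λ*(V)`). -/
def IsHomog (d : ℕ) (b : BG 𝕜 Γ) : Prop :=
  ∀ γ : Γ, b γ ∈ (LinearMap.range (ExteriorAlgebra.ι 𝕜 : V 𝕜 →ₗ[𝕜] ExtV 𝕜)) ^ d

/-- An element of degree one anticommutes with homogeneous elements up to the Koszul sign. -/
theorem ι_mul_eq_of_mem_pow {R M : Type*} [CommRing R] [AddCommGroup M] [Module R M]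
    (v : M) {n : ℕ} {y : ExteriorAlgebra R M}
    (hy : y ∈ LinearMap.range (ExteriorAlgebra.ι R : M →ₗ[R] ExteriorAlgebra R M) ^ n) :
    ExteriorAlgebra.ι R v * y = (-1 : R) ^ n • (y * ExteriorAlgebra.ι R v) := by
  induction hy using Submodule.pow_induction_on_left' with
  | algebraMap r => simp [Algebra.commutes]
  | add x y i hx hy ihx ihy => rw [mul_add, ihx, ihy, add_mul, smul_add]
  | mem_mul m hm i x hx ih =>
    obtain ⟨w, rfl⟩ := hm
    have hvw : ExteriorAlgebra.ι R v * ExteriorAlgebra.ι R w =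
        -(ExteriorAlgebra.ι R w * ExteriorAlgebra.ι R v) :=
      eq_neg_of_add_eq_zero_left (ExteriorAlgebra.ι_add_mul_swap v w)
    rw [← mul_assoc, hvw, neg_mul, mul_assoc, ih, pow_succ, mul_smul_comm, mul_assoc]
    simp

/-- Graded commutativity of the exterior algebra. -/
theorem mul_eq_of_mem_pow {R M : Type*} [CommRing R] [AddCommGroup M] [Module R M]
    {m n : ℕ} {x y : ExteriorAlgebra R M}
    (hx : x ∈ LinearMap.range (ExteriorAlgebra.ι R : M →ₗ[R] ExteriorAlgebra R M) ^ m)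
    (hy : y ∈ LinearMap.range (ExteriorAlgebra.ι R : M →ₗ[R] ExteriorAlgebra R M) ^ n) :
    x * y = (-1 : R) ^ (m * n) • (y * x) := by
  induction hx using Submodule.pow_induction_on_left' with
  | algebraMap r => simp [Algebra.commutes]
  | add x z i hx hz ihx ihz => rw [add_mul, ihx, ihz, mul_add, smul_add]
  | mem_mul v hv i x hx ih =>
    obtain ⟨w, rfl⟩ := hv
    rw [mul_assoc, ih, mul_smul_comm, ← mul_assoc, ι_mul_eq_of_mem_pow w hy, smul_mul_assoc,
      smul_smul, ← pow_add, mul_assoc, Nat.succ_mul]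

theorem actE_mem_pow {K : Type} [Field K] (f : V K →ₗ[K] V K) {n : ℕ} {x : ExtV K}
    (hx : x ∈ LinearMap.range (ExteriorAlgebra.ι K : V K →ₗ[K] ExtV K) ^ n) :
    actE K f x ∈ LinearMap.range (ExteriorAlgebra.ι K : V K →ₗ[K] ExtV K) ^ n := by
  have hle : (LinearMap.range (ExteriorAlgebra.ι K : V K →ₗ[K] ExtV K)).map
      (actE K f).toLinearMap ≤ LinearMap.range (ExteriorAlgebra.ι K : V K →ₗ[K] ExtV K) := by
    rintro _ ⟨_, ⟨v, rfl⟩, rfl⟩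
    exact ⟨f v, by simp [actE]⟩
  have hmap := Submodule.mem_map_of_mem (f := (actE K f).toLinearMap) hx
  rw [Submodule.map_pow] at hmap
  exact pow_le_pow_left' hle n hmap

theorem actE_actE_of_comp_eq_id {K : Type} [Field K] {f g : V K →ₗ[K] V K}
    (h : f ∘ₗ g = LinearMap.id) (x : ExtV K) : actE K f (actE K g x) = x := by
  have hcomp : (actE K f).comp (actE K g) = AlgHom.id K _ := by
    refine ExteriorAlgebra.hom_ext (LinearMap.ext fun v => ?_)
    simpa [actE] using congrArg (ExteriorAlgebra.ι K) (LinearMap.congr_fun h v)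
  exact DFunLike.congr_fun hcomp x

/-- The `ω`-coefficient is invariant under linear maps of determinant one. -/
theorem omegaCoeff_actE {K : Type} [Field K] {A : Matrix (Fin 2) (Fin 2) K} (hA : A.det = 1)
    (x : ExtV K) : omegaCoeff K (actE K (Matrix.toLin' A) x) = omegaCoeff K x := by
  suffices h : omegaCoeff K ∘ₗ (actE K (Matrix.toLin' A)).toLinearMap = omegaCoeff K from
    LinearMap.congr_fun h x
  refine ExteriorAlgebra.lhom_ext fun i => AlternatingMap.ext fun v => ?_
  have hact : actE K (Matrix.toLin' A) (ExteriorAlgebra.ιMulti K i v) =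
      ExteriorAlgebra.ιMulti K i fun j => Matrix.toLin' A (v j) := by
    simp [actE, ExteriorAlgebra.ιMulti_apply, map_list_prod, List.map_ofFn, Function.comp_def]
  suffices h : altFam K i (fun j => Matrix.toLin' A (v j)) = altFam K i v by
    simpa [hact, omegaCoeff, ExteriorAlgebra.liftAlternating_apply_ιMulti] using h
  match i with
  | 0 | 1 | _ + 3 => rfl
  | 2 =>
    have hrows : (fun j => Matrix.toLin' A (v j)) = Matrix.of v * A.transpose := by
      ext j k
      simp [Matrix.mul_apply, Matrix.mulVec, dotProduct, mul_comm]
    change Matrix.det (fun j => Matrix.toLin' A (v j)) = Matrix.det (Matrix.of v)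
    rw [hrows, Matrix.det_mul, Matrix.det_transpose, hA, mul_one]

theorem trB_mulB {K : Type} [Field K] (Γ : Subgroup (Matrix.SpecialLinearGroup (Fin 2) K))
    (a b : BG K Γ) :
    trB K Γ (mulB K Γ a b) = a.sum fun α x => omegaCoeff K
      (x * actE K (Matrix.toLin' (α : Matrix.SpecialLinearGroup (Fin 2) K).1) (b α⁻¹)) := by
  classical
  simp only [trB, mulB, Finsupp.sum, Finsupp.finsetSum_apply, map_sum]
  refine Finset.sum_congr rfl fun α _ => ?_
  rw [Finset.sum_eq_single α⁻¹]
  · simp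
  · intro β _ hβ
    rw [Finsupp.single_eq_of_ne, map_zero]
    exact fun h => hβ (eq_inv_of_mul_eq_one_right h.symm)
  · intro h
    simp [Finsupp.notMem_support_iff.mp h]

/-- the trace on `B^Γ = Λ*(V) ⋊ Γ` is supersymmetric: for homogeneous
`a, b ∈ B^Γ` of degrees `|a|, |b|`, `tr(a·b) = (-1)^{|a||b|}·tr(b·a)`. -/
theorem trB_supersymmetric (da db : ℕ) (a b : BG 𝕜 Γ)
    (ha : IsHomog 𝕜 Γ da a) (hb : IsHomog 𝕜 Γ db b) :
    trB 𝕜 Γ (mulB 𝕜 Γ a b) = (-1 : 𝕜) ^ (da * db) * trB 𝕜 Γ (mulB 𝕜 Γ b a) := by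
  have := Fintype.ofFinite Γ
  rw [trB_mulB, trB_mulB, Finsupp.sum_fintype _ _ (by simp), Finsupp.sum_fintype _ _ (by simp),
    Finset.mul_sum, ← Equiv.sum_comp (Equiv.inv Γ)]
  refine Finset.sum_congr rfl fun γ _ => ?_
  have hid : Matrix.toLin' (γ : Matrix.SpecialLinearGroup (Fin 2) 𝕜).1 ∘ₗ
      Matrix.toLin' ((γ⁻¹ : Γ) : Matrix.SpecialLinearGroup (Fin 2) 𝕜).1 = LinearMap.id := by
    rw [← Matrix.toLin'_mul, ← Matrix.SpecialLinearGroup.coe_mul, ← Subgroup.coe_mul]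
    simp
  simp only [Equiv.inv_apply, inv_inv]
  rw [← omegaCoeff_actE (γ : Matrix.SpecialLinearGroup (Fin 2) 𝕜).2, map_mul,
    actE_actE_of_comp_eq_id hid, mul_eq_of_mem_pow (actE_mem_pow _ (ha _)) (hb γ), map_smul,
    smul_eq_mul]
end
end

section
/- In the Heisenberg algebra 𝔥_{ℤ₂} associated to the group ℤ/2 (whose affine Dynkin diagram has two vertices joined by two edges), for i ≠ j in {0,1} and all integers n, m ≥ 0 one has q_i^{(n)}·p_j^{(m)} = p_j^{(m)}·q_i^{(n)} + 2·p_j^{(m−1)}·q_i^{(n−1)} + p_j^{(m−2)}·q_i^{(n−2)}, where terms with negative superscripts are zero. (This is the defining relation of 𝔥_{ℤ₂} from the appendix of the paper, proved to hold for the elements defined from the generators aᵢ(n).) -/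
/-!
The quantum Heisenberg algebra `𝔥_{ℤ₂}` associated to `Γ = ℤ/2` (whose affine Dynkin
diagram has two vertices `{0,1}` joined by two edges), presented over `K = ℚ(t)` by
generators `aᵢ(n)` (`i ∈ {0,1}`, `n ∈ ℤ ∖ {0}`) and the relations
`aᵢ(m)aⱼ(n) = aⱼ(n)aᵢ(m)` for `m + n ≠ 0` and
`aᵢ(-n)aⱼ(n) - aⱼ(n)aᵢ(-n) = κᵢⱼ(n)·1` for `n ≥ 1`, where
`κ₀₀(n) = κ₁₁(n) = -[2n][n]/n` and `κ₀₁(n) = κ₁₀(n) = 2(-1)ⁿ[n]²/n`.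
-/

open scoped Classical

noncomputable section

/-- Index type for the generators `aᵢ(n)`, `i ∈ {0,1}`, `n ∈ ℤ ∖ {0}`. -/
abbrev Gen2 : Type := Fin 2 × {n : ℤ // n ≠ 0}

/-- The structure constants: `κᵢᵢ(n) = -[2n][n]/n` and
`κᵢⱼ(n) = 2·(-1)ⁿ[n]²/n` for `i ≠ j` (the two vertices are joined by two edges). -/
def kappa2 (i j : Fin 2) (n : ℤ) : K :=
  if i = j then -(qint (2 * n) * qint n / (n : K))
  else 2 * ((-1 : K) ^ n * qint n ^ 2 / (n : K))

/-- The defining relations of `𝔥_{ℤ₂}`. -/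
inductive HeisRel2 : FreeAlgebra K Gen2 → FreeAlgebra K Gen2 → Prop
  | comm (i j : Fin 2) (m n : {k : ℤ // k ≠ 0}) (h : (m : ℤ) + (n : ℤ) ≠ 0) :
      HeisRel2 (FreeAlgebra.ι K (i, m) * FreeAlgebra.ι K (j, n))
        (FreeAlgebra.ι K (j, n) * FreeAlgebra.ι K (i, m))
  | heis (i j : Fin 2) (n : ℤ) (hn : 1 ≤ n) :
      HeisRel2
        (FreeAlgebra.ι K (i, ⟨-n, by omega⟩) * FreeAlgebra.ι K (j, ⟨n, by omega⟩) -
          FreeAlgebra.ι K (j, ⟨n, by omega⟩) * FreeAlgebra.ι K (i, ⟨-n, by omega⟩))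
        (algebraMap K (FreeAlgebra K Gen2) (kappa2 i j n))

/-- The Heisenberg algebra `𝔥_{ℤ₂}`. -/
abbrev HeisAlg2 : Type := RingQuot HeisRel2

/-- The generators `aᵢ(n)` (with the harmless convention `aᵢ(0) = 0`). -/
def aGen2 (i : Fin 2) (n : ℤ) : HeisAlg2 :=
  if h : n ≠ 0 then RingQuot.mkAlgHom K HeisRel2 (FreeAlgebra.ι K (i, ⟨n, h⟩)) else 0

/-- `p_i^{(n)}` for `n : ℕ`, defined by `p_i^{(0)} = 1` and the recursion
`n·p_i^{(n)} = Σ_{m=1}^{n} (m/[m])·aᵢ(-m)·p_i^{(n-m)}`. -/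
def pAux2 (i : Fin 2) : ℕ → HeisAlg2
  | 0 => 1
  | n + 1 =>
      (((n : K) + 1))⁻¹ • ∑ m ∈ Finset.range (n + 1),
        ((((m : K) + 1)) / qint ((m : ℤ) + 1)) •
          (aGen2 i (-((m : ℤ) + 1)) * pAux2 i (n - m))
  decreasing_by exact Nat.lt_succ_of_le (Nat.sub_le n m)

/-- `q_i^{(n)}` for `n : ℕ`, defined by `q_i^{(0)} = 1` and the recursion
`n·q_i^{(n)} = Σ_{m=1}^{n} (m/[m])·aᵢ(m)·q_i^{(n-m)}`. -/
def qAux2 (i : Fin 2) : ℕ → HeisAlg2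
  | 0 => 1
  | n + 1 =>
      (((n : K) + 1))⁻¹ • ∑ m ∈ Finset.range (n + 1),
        ((((m : K) + 1)) / qint ((m : ℤ) + 1)) •
          (aGen2 i ((m : ℤ) + 1) * qAux2 i (n - m))
  decreasing_by exact Nat.lt_succ_of_le (Nat.sub_le n m)

/-- `p_i^{(k)}` for `k : ℤ`, vanishing for `k < 0`. -/
def pH2 (i : Fin 2) (k : ℤ) : HeisAlg2 := if k < 0 then 0 else pAux2 i k.toNat

/-- `q_i^{(k)}` for `k : ℤ`, vanishing for `k < 0`. -/
def qH2 (i : Fin 2) (k : ℤ) : HeisAlg2 := if k < 0 then 0 else qAux2 i k.toNat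

theorem commutator_of_recursion {F R : Type*} [Field F] [CharZero F] [Ring R] [Algebra F R]
    {A B : ℕ → R} {P : ℤ → R} {c : ℕ → F}
    (hneg : ∀ n < 0, P n = 0) (hone : P 0 = 1)
    (hrec : ∀ (n : ℤ) (N : ℕ), n ≤ N →
      (n : F) • P n = ∑ k ∈ Finset.range N, B k * P (n - (k + 1)))
    (hAB : ∀ k l, A k * B l = B l * A k + if k = l then algebraMap F R (c k * (k + 1)) else 0)
    (k : ℕ) (m : ℤ) :
    A k * P m = P m * A k + c k • P (m - (k + 1)) := by
  suffices H : ∀ (M : ℕ) (m : ℤ), m < M →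
      A k * P m = P m * A k + c k • P (m - (k + 1)) from H (m.toNat + 1) m (by omega)
  intro M
  induction M with
  | zero =>
    intro m hm
    rw [hneg m (by omega), hneg _ (by omega)]
    simp
  | succ M ih =>
    intro m hm
    rcases lt_trichotomy m 0 with h | rfl | h
    · exact ih m (by omega)
    · rw [hone, hneg _ (by omega)]
      simp
    have hm0 : (m : F) ≠ 0 := by exact_mod_cast h.ne'
    apply smul_right_injective R hm0
    have hN : m ≤ (m.toNat + k + 1 : ℕ) := by omega
    have hN' : m - (k + 1) ≤ (m.toNat + k + 1 : ℕ) := by omega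
    have term : ∀ l ∈ Finset.range (m.toNat + k + 1),
        A k * (B l * P (m - (l + 1))) = B l * P (m - (l + 1)) * A k +
          c k • (B l * P (m - (k + 1) - (l + 1))) +
          if k = l then (c k * (k + 1)) • P (m - (l + 1)) else 0 := by
      intro l _
      rw [← mul_assoc, hAB, add_mul, mul_assoc, ih _ (by omega), sub_right_comm]
      split_ifs <;> simp [mul_add, mul_assoc, Algebra.smul_def, Algebra.left_comm]
    simp only [smul_add]
    rw [← mul_smul_comm, ← smul_mul_assoc, hrec m _ hN, Finset.mul_sum, Finset.sum_congr rfl term,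
      Finset.sum_add_distrib, Finset.sum_add_distrib, ← Finset.sum_mul, ← Finset.smul_sum,
      ← hrec _ _ hN', Finset.sum_ite_eq, if_pos (Finset.mem_range.mpr (by omega)),
      add_assoc, smul_smul, smul_smul, ← add_smul]
    congr 2
    push_cast
    ring

theorem mul_of_recursion {F R : Type*} [Field F] [CharZero F] [Ring R] [Algebra F R]
    {A : ℕ → R} {P Q : ℤ → R}
    (hneg : ∀ n < 0, Q n = 0) (hone : Q 0 = 1)
    (hrec : ∀ (n : ℤ) (N : ℕ), n ≤ N →
      (n : F) • Q n = ∑ k ∈ Finset.range N, A k * Q (n - (k + 1)))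
    (hAP : ∀ (k : ℕ) (m : ℤ), A k * P m = P m * A k + (2 * (-1 : F) ^ k) • P (m - (k + 1)))
    (n m : ℤ) :
    Q n * P m = P m * Q n + (2 : F) • (P (m - 1) * Q (n - 1)) + P (m - 2) * Q (n - 2) := by
  suffices H : ∀ (M : ℕ) (n : ℤ), n < M → Q n * P m =
      P m * Q n + (2 : F) • (P (m - 1) * Q (n - 1)) + P (m - 2) * Q (n - 2) from
    H (n.toNat + 1) n (by omega)
  intro M
  induction M with
  | zero =>
    intro n hn
    rw [hneg n (by omega), hneg (n - 1) (by omega), hneg (n - 2) (by omega)]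
    simp
  | succ M ih =>
    intro n hn
    rcases lt_trichotomy n 0 with h | rfl | h
    · exact ih n (by omega)
    · rw [hone, hneg (0 - 1) (by omega), hneg (0 - 2) (by omega)]
      simp
    have hn0 : (n : F) ≠ 0 := by exact_mod_cast h.ne'
    apply smul_right_injective R hn0
    obtain ⟨N, rfl⟩ : ∃ N : ℕ, n = N := ⟨n.toNat, by omega⟩
    set y : ℕ → R := fun k => P (m - (k + 1)) * Q (N - (k + 1)) +
      P (m - (k + 2)) * Q (N - (k + 2)) with hy
    have tele : ∀ r : ℕ, ∑ k ∈ Finset.range r, (2 * (-1 : F) ^ k) • (y k + y (k + 1)) =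
        (2 : F) • y 0 - (2 * (-1 : F) ^ r) • y r := by
      intro r
      induction r with
      | zero => simp
      | succ r ihr =>
        rw [Finset.sum_range_succ, ihr, pow_succ]
        module
    have hyN : y N = 0 := by
      simp only [hy]
      rw [hneg (N - (N + 1)) (by omega), hneg (N - (N + 2)) (by omega)]
      simp
    have term : ∀ k ∈ Finset.range N, A k * Q (N - (k + 1)) * P m =
        P m * (A k * Q (N - (k + 1))) + (2 : F) • (P (m - 1) * (A k * Q (N - 1 - (k + 1)))) +
          P (m - 2) * (A k * Q (N - 2 - (k + 1))) +
          (2 * (-1 : F) ^ k) • (y k + y (k + 1)) := by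
      intro k _
      rw [mul_assoc, ih _ (by omega), mul_add, mul_add, mul_smul_comm, ← mul_assoc, ← mul_assoc,
        ← mul_assoc, hAP, hAP, hAP]
      simp only [hy]
      push_cast
      rw [show m - 1 - ((k : ℤ) + 1) = m - (k + 2) by ring,
        show m - 2 - ((k : ℤ) + 1) = m - (k + 3) by ring,
        show (N : ℤ) - (k + 1) - 1 = N - (k + 2) by ring,
        show (N : ℤ) - (k + 1) - 2 = N - (k + 3) by ring,
        show (N : ℤ) - 1 - (k + 1) = N - (k + 2) by ring,
        show (N : ℤ) - 2 - (k + 1) = N - (k + 3) by ring,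
        show m - ((k : ℤ) + 1 + 1) = m - (k + 2) by ring,
        show m - ((k : ℤ) + 1 + 2) = m - (k + 3) by ring,
        show (N : ℤ) - (k + 1 + 1) = N - (k + 2) by ring,
        show (N : ℤ) - (k + 1 + 2) = N - (k + 3) by ring]
      simp only [add_mul, smul_mul_assoc, mul_assoc]
      module
    beta_reduce
    rw [← smul_mul_assoc, hrec N N le_rfl, Finset.sum_mul, Finset.sum_congr rfl term,
      Finset.sum_add_distrib, Finset.sum_add_distrib, Finset.sum_add_distrib, ← Finset.mul_sum,
      ← Finset.smul_sum, ← Finset.mul_sum, ← Finset.mul_sum, ← hrec N N le_rfl,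
      ← hrec (N - 1) N (by omega), ← hrec (N - 2) N (by omega), tele, hyN]
    simp only [hy, mul_smul_comm]
    push_cast
    module

theorem recursion_int {R : Type*} [Ring R] [Algebra K R] {a : ℕ → R} {x : ℕ → R}
    (hx : ∀ n, x (n + 1) = (((n : K) + 1))⁻¹ • ∑ k ∈ Finset.range (n + 1),
      ((((k : K) + 1)) / qint ((k : ℤ) + 1)) • (a k * x (n - k)))
    (n : ℤ) (N : ℕ) (hn : n ≤ N) :
    (n : K) • (if n < 0 then 0 else x n.toNat) =
      ∑ k ∈ Finset.range N, ((((k : K) + 1)) / qint ((k : ℤ) + 1)) • a k *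
        (if n - (k + 1) < 0 then 0 else x (n - (k + 1)).toNat) := by
  rcases le_or_gt n 0 with h | h
  · rw [Finset.sum_eq_zero]
    · rcases h.lt_or_eq with h | rfl <;> simp [*]
    · intro k _
      rw [if_pos (by omega), mul_zero]
  obtain ⟨n, rfl⟩ : ∃ r : ℕ, n = r + 1 := ⟨(n - 1).toNat, by omega⟩
  have hn' : ((n : K) + 1) ≠ 0 := by exact_mod_cast n.succ_ne_zero
  rw [if_neg (by omega), show ((n : ℤ) + 1).toNat = n + 1 by omega, hx]
  push_cast
  rw [smul_inv_smul₀ hn']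
  rw [← Finset.sum_subset (Finset.range_subset_range.mpr (show n + 1 ≤ N by omega))]
  · refine Finset.sum_congr rfl fun k hk => ?_
    have := Finset.mem_range.mp hk
    rw [if_neg (by omega), smul_mul_assoc, show ((n : ℤ) + 1 - (k + 1)).toNat = n - k by omega]
  · intro k _ hk
    rw [Finset.mem_range] at hk
    rw [if_pos (by omega), mul_zero]

theorem aGen2_mul_aGen2_neg (i j : Fin 2) (k l : ℕ) :
    aGen2 i ((k : ℤ) + 1) * aGen2 j (-((l : ℤ) + 1)) =
      aGen2 j (-((l : ℤ) + 1)) * aGen2 i ((k : ℤ) + 1) -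
        if k = l then algebraMap K HeisAlg2 (kappa2 j i ((k : ℤ) + 1)) else 0 := by
  rw [aGen2, aGen2, dif_pos (by omega), dif_pos (by omega)]
  split_ifs with h
  · subst h
    have := RingQuot.mkAlgHom_rel K (HeisRel2.heis j i ((k : ℤ) + 1) (by omega))
    rw [map_sub, map_mul, map_mul, AlgHom.commutes] at this
    rw [← this, sub_sub_cancel]
  · rw [sub_zero, ← map_mul, ← map_mul]
    exact RingQuot.mkAlgHom_rel K (HeisRel2.comm i j ⟨(k : ℤ) + 1, by omega⟩
      ⟨-((l : ℤ) + 1), by omega⟩ (by simp only; omega))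

theorem scaled_aGen2_mul {i j : Fin 2} (hij : i ≠ j) (k l : ℕ) :
    (((k : K) + 1) / qint ((k : ℤ) + 1)) • aGen2 i ((k : ℤ) + 1) *
        ((((l : K) + 1) / qint ((l : ℤ) + 1)) • aGen2 j (-((l : ℤ) + 1))) =
      (((l : K) + 1) / qint ((l : ℤ) + 1)) • aGen2 j (-((l : ℤ) + 1)) *
        ((((k : K) + 1) / qint ((k : ℤ) + 1)) • aGen2 i ((k : ℤ) + 1)) +
      if k = l then algebraMap K HeisAlg2 (2 * (-1) ^ k * (k + 1)) else 0 := by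
  rw [smul_mul_smul_comm, smul_mul_smul_comm, aGen2_mul_aGen2_neg, smul_sub, mul_comm,
    sub_eq_add_neg]
  congr 1
  split_ifs with h
  · subst h
    have hq : qint ((k : ℤ) + 1) ≠ 0 := by exact_mod_cast qint_ne_zero k.succ_ne_zero
    have hk : (k : K) + 1 ≠ 0 := by exact_mod_cast k.succ_ne_zero
    rw [← algebraMap_smul HeisAlg2, smul_eq_mul, ← map_mul, ← map_neg]
    congr 1
    rw [kappa2, if_neg hij.symm, zpow_add₀ (by simp), zpow_natCast]
    push_cast
    field_simp
  · simp

/-- appendix of the paper: in `𝔥_{ℤ₂}`, for `i ≠ j` in `{0,1}`,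
`q_i^{(n)}·p_j^{(m)} = p_j^{(m)}·q_i^{(n)} + 2·p_j^{(m-1)}·q_i^{(n-1)}
 + p_j^{(m-2)}·q_i^{(n-2)}` (terms with negative superscripts vanish). -/
theorem heisenberg_z2_rel_qp_offdiagonal (i j : Fin 2) (hij : i ≠ j) (n m : ℕ) :
    qH2 i n * pH2 j m =
      pH2 j m * qH2 i n +
        (2 : K) • (pH2 j ((m : ℤ) - 1) * qH2 i ((n : ℤ) - 1)) +
        pH2 j ((m : ℤ) - 2) * qH2 i ((n : ℤ) - 2) := by
  refine mul_of_recursion (F := K)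
    (A := fun k => (((k : K) + 1) / qint ((k : ℤ) + 1)) • aGen2 i ((k : ℤ) + 1))
    (P := pH2 j) (Q := qH2 i) (fun n hn => if_pos hn) (by simp [qH2, qAux2])
    ?_ ?_ n m
  · exact recursion_int fun n => by rw [qAux2]
  · exact commutator_of_recursion
      (B := fun k => (((k : K) + 1) / qint ((k : ℤ) + 1)) • aGen2 j (-((k : ℤ) + 1)))
      (fun n hn => if_pos hn) (by simp [pH2, pAux2])
      (recursion_int fun n => by rw [pAux2]) (scaled_aGen2_mul hij)
end
end
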